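/- Let T be the binary tree and suppose α(t)σ(t) ≥ c 2^{-(γ/q)|t|} for all t ∈ T, for some γ > 0 and c > 0. Then there is a constant c' > 0 such that e_n(V_{α,σ} : ℓ_1(T) → ℓ_q(T)) ≥ c' n^{-γ/q − 1/q'} for all n ≥ 1, where 1/q' = 1 − 1/q. -/

import Mathlib

open scoped ENNReal NNReal
open MeasureTheory

noncomputable section

/-- A rooted tree structure on a partially ordered type with bottom element (the root):
the set of ancestors of any node is finite and totally ordered, and every node has
finitely many offspring (covering elements). -/
def IsTree (T : Type) [PartialOrder T] [OrderBot T] : Prop :=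
  (∀ s : T, (Set.Iic s).Finite) ∧
  (∀ s a b : T, a ≤ s → b ≤ s → a ≤ b ∨ b ≤ a) ∧
  (∀ t : T, {s : T | t ⋖ s}.Finite)

/-- The binary tree: a rooted tree in which every node has exactly two offspring. -/
def IsBinaryTree (T : Type) [PartialOrder T] [OrderBot T] : Prop :=
  IsTree T ∧ ∀ t : T, Nat.card {s : T | t ⋖ s} = 2

/-- `glb` assigns to any two nodes their greatest common ancestor. -/
def IsGCA {T : Type} [PartialOrder T] (glb : T → T → T) : Prop :=
  ∀ t s : T, glb t s ≤ t ∧ glb t s ≤ s ∧ ∀ u : T, u ≤ t → u ≤ s → u ≤ glb t s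

/-- The generation `|t|` of a node: the number of its strict ancestors. -/
def gen {T : Type} [PartialOrder T] (t : T) : ℕ := Nat.card (Set.Iio t)

/-- The distance `max_{t ≺ v ⪯ s} (∑_{t ≺ r ⪯ v} α(r)^q)^{1/q} σ(v)` along a branch. -/
def dOrd {T : Type} [PartialOrder T] (q : ℝ) (α σ : T → ℝ) (t s : T) : ℝ :=
  sSup ((fun v => (∑ᶠ r ∈ Set.Ioc t v, α r ^ q) ^ (1 / q) * σ v) '' Set.Ioc t s)

/- The tree metric `d`, extended by symmetry and via greatest common ancestors. -/
open Classical in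
def treeDist {T : Type} [PartialOrder T] (q : ℝ) (α σ : T → ℝ)
    (glb : T → T → T) (t s : T) : ℝ :=
  if t ≤ s then dOrd q α σ t s
  else if s ≤ t then dOrd q α σ s t
  else dOrd q α σ (glb t s) t + dOrd q α σ (glb t s) s

/-- `N(T,d,ε)`: minimal number of open `ε`-balls needed to cover `T` (`∞` if none). -/
def coveringNumber {T : Type} (d : T → T → ℝ) (ε : ℝ) : ℝ≥0∞ :=
  ⨅ S ∈ {S : Finset T | ∀ t : T, ∃ s ∈ S, d s t < ε}, (S.card : ℝ≥0∞)

/-- `Ñ(T,d,ε)`: minimal cardinality of an order `ε`-net of `T`. -/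
def orderCoveringNumber {T : Type} [PartialOrder T] (d : T → T → ℝ) (ε : ℝ) : ℝ≥0∞ :=
  ⨅ S ∈ {S : Finset T | ∀ t : T, ∃ s ∈ S, s ≤ t ∧ d s t < ε}, (S.card : ℝ≥0∞)

/-- Minimal number of open `ε`-balls of a normed space needed to cover the set `A`. -/
def setCoveringNumber {Y : Type} [NormedAddCommGroup Y] (A : Set Y) (ε : ℝ) : ℝ≥0∞ :=
  ⨅ F ∈ {F : Finset Y | ∀ a ∈ A, ∃ y ∈ F, ‖a - y‖ < ε}, (F.card : ℝ≥0∞)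

/-- The dyadic entropy numbers `e_n(V)` of an operator `V`. -/
def entropyNumber {X Y : Type} [NormedAddCommGroup X] [NormedSpace ℝ X]
    [NormedAddCommGroup Y] [NormedSpace ℝ Y] (n : ℕ) (V : X →L[ℝ] Y) : ℝ :=
  sInf {ε : ℝ | 0 < ε ∧ ∃ F : Finset Y, F.card ≤ 2 ^ (n - 1) ∧
    ∀ x : X, ‖x‖ ≤ 1 → ∃ y ∈ F, ‖V x - y‖ < ε}

/-- The space `ℓ₁(T)`. -/
abbrev ellOne (T : Type) := lp (fun _ : T => ℝ) 1

/-- The space `ℓ_q(T)`. -/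
abbrev ellQ (T : Type) (q : ℝ) := lp (fun _ : T => ℝ) (ENNReal.ofReal q)

/-- In a tree, the strict ancestors of an offspring of `t` are the ancestors of `t`. -/
theorem IsTree.Iio_eq_Iic_of_covBy {T : Type} [PartialOrder T] [OrderBot T] (hT : IsTree T)
    {t s : T} (h : t ⋖ s) : Set.Iio s = Set.Iic t := by
  ext r
  refine ⟨fun hr => ?_, fun hr => lt_of_le_of_lt hr h.lt⟩
  rcases hT.2.1 s r t (le_of_lt hr) h.le with h1 | h1
  · exact h1
  · rcases h1.lt_or_eq with h2 | h2
    · exact absurd hr (h.2 h2)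
    · exact h2.ge

theorem IsTree.gen_lt_gen {T : Type} [PartialOrder T] [OrderBot T] (hT : IsTree T)
    {t s : T} (h : t < s) : gen t < gen s := by
  refine Set.ncard_lt_ncard ?_ ((hT.1 s).subset Set.Iio_subset_Iic_self)
  refine ⟨Set.Iio_subset_Iio h.le, fun hsub => ?_⟩
  exact lt_irrefl t (hsub (show t ∈ Set.Iio s from h))

theorem IsTree.gen_of_covBy {T : Type} [PartialOrder T] [OrderBot T] (hT : IsTree T)
    {t s : T} (h : t ⋖ s) : gen s = gen t + 1 := by
  have h1 : gen s = (Set.Iic t).ncard := by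
    rw [← hT.Iio_eq_Iic_of_covBy h]; rfl
  rw [h1, ← Set.Iio_insert, Set.ncard_insert_of_notMem (by simp)
    ((hT.1 t).subset Set.Iio_subset_Iic_self)]
  rfl

/-- The binary tree has at least `2 ^ m` nodes of generation `m`. -/
theorem IsBinaryTree.exists_generation {T : Type} [PartialOrder T] [OrderBot T]
    (hT : IsBinaryTree T) (m : ℕ) :
    ∃ L : Finset T, L.card = 2 ^ m ∧ ∀ t ∈ L, gen t = m := by
  classical
  induction m with
  | zero => exact ⟨{⊥}, by simp, by simp [gen]⟩
  | succ m ih =>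
    obtain ⟨L, hcard, hgen⟩ := ih
    have hfin : ∀ t : T, {s : T | t ⋖ s}.Finite := hT.1.2.2
    refine ⟨L.biUnion fun t => (hfin t).toFinset, ?_, ?_⟩
    · rw [Finset.card_biUnion]
      · have h2 : ∀ t ∈ L, (hfin t).toFinset.card = 2 := fun t _ => by
          rw [← Set.ncard_eq_toFinset_card _ (hfin t)]
          exact hT.2 t
        rw [Finset.sum_congr rfl h2, Finset.sum_const, hcard, smul_eq_mul, pow_succ]
      · intro t _ t' _ hne
        refine Finset.disjoint_left.2 ?_
        intro s hs hs'
        simp only [Set.Finite.mem_toFinset, Set.mem_ofPred_eq] at hs hs'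
        apply hne
        have := (hT.1.Iio_eq_Iic_of_covBy hs).symm.trans (hT.1.Iio_eq_Iic_of_covBy hs')
        exact Set.Iic_injective this
    · intro s hs
      simp only [Finset.mem_biUnion, Set.Finite.mem_toFinset, Set.mem_ofPred_eq] at hs
      obtain ⟨t, ht, hts⟩ := hs
      rw [hT.1.gen_of_covBy hts, hgen t ht]

/-- A Chernoff bound for the number of small subsets. -/
theorem card_filter_card_le_le {T : Type} (L : Finset T) (M : ℕ) (hL : L.card = 8 * M) :
    (L.powerset.filter fun A => A.card ≤ M).card ≤ 32 ^ M := by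
  have h1 : ∑ A ∈ L.powerset, 1 ^ A.card * 7 ^ (L.card - A.card) = (1 + 7) ^ L.card :=
    Finset.sum_pow_mul_eq_add_pow 1 7 L
  have h2 : (L.powerset.filter fun A => A.card ≤ M).card * 7 ^ (7 * M) ≤ 8 ^ (8 * M) := by
    calc (L.powerset.filter fun A => A.card ≤ M).card * 7 ^ (7 * M)
        = ∑ A ∈ L.powerset.filter (fun A => A.card ≤ M), 7 ^ (7 * M) := by
          rw [Finset.sum_const, smul_eq_mul]
      _ ≤ ∑ A ∈ L.powerset.filter (fun A => A.card ≤ M),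
            1 ^ A.card * 7 ^ (L.card - A.card) := by
          refine Finset.sum_le_sum fun A hA => ?_
          rw [one_pow, one_mul]
          refine Nat.pow_le_pow_right (by norm_num) ?_
          have := (Finset.mem_filter.1 hA).2
          omega
      _ ≤ ∑ A ∈ L.powerset, 1 ^ A.card * 7 ^ (L.card - A.card) :=
          Finset.sum_le_sum_of_subset (Finset.filter_subset _ _)
      _ = 8 ^ (8 * M) := by rw [h1, hL]
  have h3 : 8 ^ (8 * M) ≤ 32 ^ M * 7 ^ (7 * M) := by
    rw [pow_mul, pow_mul, ← mul_pow]
    exact Nat.pow_le_pow_left (by norm_num) M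
  exact Nat.le_of_mul_le_mul_right (h2.trans h3) (by positivity)

open scoped symmDiff in
/-- Hamming balls of radius `M` in a cube of dimension `8 * M` have at most `32 ^ M` points. -/
theorem card_filter_symmDiff_le {T : Type} [DecidableEq T] (L B : Finset T) (M : ℕ)
    (hL : L.card = 8 * M) (hB : B ⊆ L) :
    (L.powerset.filter fun A => (A ∆ B).card ≤ M).card ≤ 32 ^ M := by
  refine le_trans (Finset.card_le_card_of_injOn (fun A => A ∆ B) ?_ ?_)
    (card_filter_card_le_le L M hL)
  · intro A hA
    simp only [Finset.coe_filter, Finset.mem_powerset, Set.mem_ofPred_eq] at hA ⊢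
    exact ⟨fun t ht => (Finset.mem_symmDiff.1 ht).elim (fun h => hA.1 h.1) (fun h => hB h.1),
      hA.2⟩
  · intro A _ A' _ h
    exact symmDiff_left_injective B h

open scoped symmDiff in
/-- If the points `u A`, indexed by the subsets `A` of `L`, have coordinates of modulus at least
`δ` on `L` with sign determined by `A`, then they are not covered by few balls of `ℓ_q`. -/
theorem rpow_mul_le_of_forall_powerset_exists_norm_sub_lt {T : Type} [DecidableEq T] {q : ℝ}
    (hq : 1 < q) [Fact (1 ≤ ENNReal.ofReal q)] {L : Finset T} {M n : ℕ} (hM : n ≤ M)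
    (hn : 1 ≤ n) (hL : L.card = 8 * M)
    {δ ε : ℝ} (hδ : 0 < δ) (hε : 0 < ε) (u : Finset T → ellQ T q)
    (hpos : ∀ A, ∀ t ∈ L, t ∈ A → δ ≤ (u A : ∀ _ : T, ℝ) t)
    (hneg : ∀ A, ∀ t ∈ L, t ∉ A → (u A : ∀ _ : T, ℝ) t ≤ -δ)
    (F : Finset (ellQ T q)) (hF : F.card ≤ 2 ^ (n - 1))
    (hcov : ∀ A ⊆ L, ∃ y ∈ F, ‖u A - y‖ < ε) :
    (M : ℝ) ^ (1 / q) * δ ≤ ε := by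
  classical
  by_contra! hlt
  have hq0 : 0 < q := by linarith
  have htr : (ENNReal.ofReal q).toReal = q := ENNReal.toReal_ofReal hq0.le
  have hlt' : ε ^ q < M * δ ^ q := by
    have := Real.rpow_lt_rpow hε.le hlt hq0
    rwa [Real.mul_rpow (by positivity) hδ.le, ← Real.rpow_mul (by positivity),
      one_div_mul_cancel hq0.ne', Real.rpow_one] at this
  let B : ellQ T q → Finset T := fun y => L.filter fun t => 0 ≤ (y : ∀ _ : T, ℝ) t
  have hsub : L.powerset ⊆
      F.biUnion fun y => L.powerset.filter fun A => (A ∆ B y).card ≤ M := by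
    intro A hA
    have hAL := Finset.mem_powerset.1 hA
    obtain ⟨y, hy, hyA⟩ := hcov A hAL
    refine Finset.mem_biUnion.2 ⟨y, hy, Finset.mem_filter.2 ⟨hA, ?_⟩⟩
    have hcoord : ∀ t ∈ A ∆ B y, δ ^ q ≤ ‖(u A - y : ∀ _ : T, ℝ) t‖ ^ q := by
      intro t ht
      refine Real.rpow_le_rpow hδ.le ?_ hq0.le
      simp only [Pi.sub_apply, Real.norm_eq_abs]
      rcases Finset.mem_symmDiff.1 ht with ⟨h1, h2⟩ | ⟨h1, h2⟩
      · have h3 : (y : ∀ _ : T, ℝ) t < 0 := by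
          by_contra! h
          exact h2 (Finset.mem_filter.2 ⟨hAL h1, h⟩)
        have := hpos A t (hAL h1) h1
        exact le_trans (by linarith) (le_abs_self _)
      · have h3 := Finset.mem_filter.1 h1
        have := hneg A t h3.1 h2
        exact le_trans (by linarith [h3.2]) (neg_le_abs _)
    have hsum : ((A ∆ B y).card : ℝ) * δ ^ q ≤ ‖u A - y‖ ^ q := by
      have := lp.sum_rpow_le_norm_rpow (p := ENNReal.ofReal q) (by rw [htr]; exact hq0)
        (u A - y) (A ∆ B y)
      rw [htr] at this
      refine le_trans ?_ this
      rw [← nsmul_eq_mul]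
      exact Finset.card_nsmul_le_sum _ _ _ hcoord
    have hfin : ((A ∆ B y).card : ℝ) * δ ^ q < M * δ ^ q :=
      (hsum.trans (Real.rpow_le_rpow (norm_nonneg _) hyA.le hq0.le)).trans_lt hlt'
    have := lt_of_mul_lt_mul_right hfin (by positivity)
    exact_mod_cast this.le
  have hcard := (Finset.card_le_card hsub).trans
    (Finset.card_biUnion_le_card_mul F _ (32 ^ M) fun y _ =>
      card_filter_symmDiff_le L (B y) M hL (Finset.filter_subset _ _))
  rw [Finset.card_powerset, hL] at hcard
  have h1 : F.card * 32 ^ M ≤ 2 ^ (n - 1 + 5 * M) := by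
    rw [pow_add, pow_mul]
    exact Nat.mul_le_mul_right _ hF
  have h2 := (Nat.pow_le_pow_iff_right (by norm_num : 1 < 2)).1 (hcard.trans h1)
  omega

/-- A finitely supported vector in the unit ball of `ℓ₁` with prescribed coordinates. -/
theorem exists_ellOne_of_abs_le {T : Type} (L : Finset T) (z : T → ℝ)
    (hz : ∀ t, |z t| ≤ (L.card : ℝ)⁻¹) :
    ∃ x : ellOne T, ‖x‖ ≤ 1 ∧ (∀ t ∈ L, (x : ∀ _ : T, ℝ) t = z t) ∧
      ∀ t ∉ L, (x : ∀ _ : T, ℝ) t = 0 := by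
  classical
  have hcoe : ∀ t, ((∑ s ∈ L, lp.single 1 s (z s) : ellOne T) : ∀ _ : T, ℝ) t =
      if t ∈ L then z t else 0 := by
    intro t
    rw [lp.coeFn_sum, Finset.sum_apply]
    simp [Pi.single_apply]
  refine ⟨∑ t ∈ L, lp.single 1 t (z t), ?_, fun t ht => ?_, fun t ht => ?_⟩
  · refine (norm_sum_le _ _).trans ?_
    calc ∑ t ∈ L, ‖(lp.single 1 t (z t) : ellOne T)‖ ≤ ∑ _t ∈ L, (L.card : ℝ)⁻¹ :=
          Finset.sum_le_sum fun t _ => by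
            rw [lp.norm_single (by norm_num)]; exact hz t
      _ ≤ 1 := by
          rw [Finset.sum_const, nsmul_eq_mul]
          exact mul_inv_le_one
  · rw [hcoe, if_pos ht]
  · rw [hcoe, if_neg ht]

theorem stmt18 {T : Type} [Countable T] [PartialOrder T] [OrderBot T]
    (hbin : IsBinaryTree T) (q : ℝ) (hq : 1 < q)
    (α σ : T → ℝ) (hα : ∀ t, 0 < α t) (hσpos : ∀ t, 0 < σ t)
    (hσmono : ∀ ⦃t s : T⦄, t ≤ s → σ s ≤ σ t)
    (K : ℝ) (hK : ∀ s : T, (∑ᶠ r ∈ Set.Iic s, α r ^ q) ^ (1 / q) * σ s ≤ K)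
    [Fact (1 ≤ ENNReal.ofReal q)]
    (V : ellOne T →L[ℝ] ellQ T q)
    (hV : ∀ (x : ellOne T) (t : T), (V x : ∀ _ : T, ℝ) t =
      α t * ∑' s : {s : T // t ≤ s}, σ s.1 * (x : ∀ _ : T, ℝ) s.1)
    (c γ : ℝ) (hc : 0 < c) (hγ : 0 < γ)
    (hw : ∀ t : T, c * (2 : ℝ) ^ (-(γ / q) * (gen t : ℝ)) ≤ α t * σ t)
    (q' : ℝ) (hq' : 1 / q' = 1 - 1 / q) :
    ∃ c' > 0, ∀ n : ℕ, 1 ≤ n →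
      c' * (n : ℝ) ^ (-(γ / q) - 1 / q') ≤ entropyNumber n V := by
  classical
  have hq0 : 0 < q := by linarith
  have hinv : 1 / q < 1 := by rw [div_lt_one hq0]; exact hq
  have he : -(γ / q) - 1 / q' ≤ 0 := by
    rw [hq']
    have : 0 < γ / q := by positivity
    linarith
  refine ⟨c * (8 : ℝ)⁻¹ ^ (1 / q) * 16 ^ (-(γ / q) - 1 / q'), by positivity, fun n hn => ?_⟩
  have hn0 : (0 : ℝ) < n := by exact_mod_cast hn
  refine le_csInf ⟨‖V‖ + 1, by positivity, {0}, by simpa using Nat.one_le_two_pow,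
    fun x hx => ⟨0, by simp, ?_⟩⟩ ?_
  · rw [sub_zero]
    have := V.le_of_opNorm_le_of_le le_rfl hx
    linarith
  rintro ε ⟨hε, F, hF, hcov⟩
  obtain ⟨k, hk1, hk2⟩ : ∃ k : ℕ, n ≤ 2 ^ k ∧ 2 ^ k ≤ 2 * n := by
    refine ⟨Nat.log 2 n + 1, (Nat.lt_pow_succ_log_self (by norm_num) n).le, ?_⟩
    have := Nat.pow_log_le_self 2 (show n ≠ 0 by omega)
    rw [pow_succ]
    omega
  obtain ⟨L, hcard, hgen⟩ := hbin.exists_generation (k + 3)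
  have hL : L.card = 8 * 2 ^ k := by rw [hcard, pow_add]; ring
  have hN : (L.card : ℝ) = 8 * 2 ^ k := by rw [hL]; push_cast; ring
  set N : ℝ := (L.card : ℝ) with hNdef
  have hN0 : 0 < N := by rw [hN]; positivity
  have hweight : ∀ t ∈ L, c * N ^ (-(γ / q)) ≤ α t * σ t := by
    intro t ht
    have h1 := hw t
    rw [hgen t ht] at h1
    have h2 : N = (2 : ℝ) ^ ((k + 3 : ℕ) : ℝ) := by
      rw [Real.rpow_natCast, hNdef, hcard]; push_cast; rfl
    rwa [h2, ← Real.rpow_mul (by norm_num), mul_comm (_ : ℝ) (-(γ / q))]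
  choose x hxnorm hxL hxout using fun A : Finset T =>
    exists_ellOne_of_abs_le L (fun t => if t ∈ A then N⁻¹ else -N⁻¹) (fun t => by
      have := inv_pos.2 hN0
      split_ifs
      · rw [abs_of_pos this]
      · rw [abs_neg, abs_of_pos this])
  have hVx : ∀ A, ∀ t ∈ L, (V (x A) : ∀ _ : T, ℝ) t =
      α t * σ t * (if t ∈ A then N⁻¹ else -N⁻¹) := by
    intro A t ht
    rw [hV, tsum_eq_single ⟨t, le_rfl⟩, hxL A t ht, mul_assoc]
    rintro ⟨s, hs⟩ hne
    have hsL : s ∉ L := fun hsL => by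
      rcases hs.lt_or_eq with h | h
      · have := hbin.1.gen_lt_gen h
        rw [hgen t ht, hgen s hsL] at this
        exact lt_irrefl _ this
      · exact hne (Subtype.ext h.symm)
    rw [hxout A s hsL, mul_zero]
  have hmain := rpow_mul_le_of_forall_powerset_exists_norm_sub_lt hq hk1 hn hL
    (δ := c * N ^ (-(γ / q)) * N⁻¹) (by positivity) hε (fun A => V (x A))
    (fun A t ht hA => by
      rw [hVx A t ht, if_pos hA]
      exact mul_le_mul_of_nonneg_right (hweight t ht) (by positivity))
    (fun A t ht hA => by
      rw [hVx A t ht, if_neg hA, mul_neg, neg_le_neg_iff]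
      exact mul_le_mul_of_nonneg_right (hweight t ht) (by positivity))
    F hF (fun A _ => hcov (x A) (hxnorm A))
  refine le_trans ?_ hmain
  have hMN : ((2 ^ k : ℕ) : ℝ) = 8⁻¹ * N := by rw [hN]; push_cast; ring
  have hpow : N ^ (-(γ / q) - 1 / q') = N ^ (1 / q) * N ^ (-(γ / q)) * N⁻¹ := by
    rw [hq', ← Real.rpow_neg_one N, ← Real.rpow_add hN0, ← Real.rpow_add hN0]
    congr 1
    ring
  have hNn : N ≤ 16 * n := by
    have : (2 : ℝ) ^ k ≤ 2 * n := by exact_mod_cast hk2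
    rw [hN]
    linarith
  calc c * (8 : ℝ)⁻¹ ^ (1 / q) * 16 ^ (-(γ / q) - 1 / q') * (n : ℝ) ^ (-(γ / q) - 1 / q')
      = c * (8 : ℝ)⁻¹ ^ (1 / q) * (16 * n : ℝ) ^ (-(γ / q) - 1 / q') := by
        rw [Real.mul_rpow (by norm_num) hn0.le, mul_assoc]
    _ ≤ c * (8 : ℝ)⁻¹ ^ (1 / q) * N ^ (-(γ / q) - 1 / q') := by
        gcongr ?_ * ?_
        exact Real.rpow_le_rpow_of_nonpos hN0 hNn he
    _ = ((2 ^ k : ℕ) : ℝ) ^ (1 / q) * (c * N ^ (-(γ / q)) * N⁻¹) := by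
        rw [hMN, Real.mul_rpow (by norm_num) hN0.le, hpow]
        ring
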